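/- There is an absolute constant C such that the following holds. Let α ≥ 1, let μ be a Radon measure on ℝ², and let 𝓘 be a family of pairwise disjoint intervals in 𝕋. Let x ∈ ℝ², r > 0, and assume that for every I ∈ 𝓘 there exist θ_I ∈ αI and y_I ∈ B_I(x,αr) with μ_{θ_I}^⊥(y_I) ≤ M. Then, setting H = ∪_{I∈𝓘} I, we have μ(X(x,H,r)) ≤ C·α²·M·ℋ¹(H)·r. -/

import Mathlib

open MeasureTheory Metric Set
open scoped ENNReal NNReal

noncomputable section

abbrev R2 := EuclideanSpace ℝ (Fin 2)

/-- The unit vector in direction `2πθ`. -/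
def dir (θ : ℝ) : R2 :=
  (EuclideanSpace.equiv (Fin 2) ℝ).symm ![Real.cos (2 * Real.pi * θ), Real.sin (2 * Real.pi * θ)]

/-- Orthogonal projection `π_θ`. -/
def proj (θ : ℝ) (x : R2) : ℝ :=
  x 0 * Real.cos (2 * Real.pi * θ) + x 1 * Real.sin (2 * Real.pi * θ)

/-- `π_θ^⊥ = π_{θ+1/4}`. -/
def projPerp (θ : ℝ) (x : R2) : ℝ := proj (θ + 1/4) x

/-- Favard length. -/
def Fav (E : Set R2) : ℝ≥0∞ := ∫⁻ θ in Set.Icc (0:ℝ) 1, μH[1] (proj θ '' E)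

/-- Ahlfors regularity with constant `A`. -/
def AhlforsRegular (A : ℝ) (E : Set R2) : Prop :=
  IsClosed E ∧ ∀ x ∈ E, ∀ r : ℝ, 0 < r → ENNReal.ofReal r < EMetric.diam E →
    ENNReal.ofReal (A⁻¹ * r) ≤ μH[1] (E ∩ ball x r) ∧
      μH[1] (E ∩ ball x r) ≤ ENNReal.ofReal (A * r)

/-- A Lipschitz graph with constant `L`: rotated graph of an `L`-Lipschitz function. -/
def IsLipschitzGraph (L : ℝ) (Γ : Set R2) : Prop :=
  ∃ (R : R2 ≃ₗᵢ[ℝ] R2) (f : ℝ → ℝ), LipschitzWith (Real.toNNReal L) f ∧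
    Γ = R '' {x : R2 | x 1 = f (x 0)}

/-- The (untruncated) cone `X(x,G)`. -/
def cone (x : R2) (G : Set ℝ) : Set R2 := ⋃ θ ∈ G, {y | ∃ t : ℝ, y = x + t • dir θ}

/-- The truncated cone `X(x,G,r)`. -/
def coneT (x : R2) (G : Set ℝ) (r : ℝ) : Set R2 := cone x G ∩ ball x r

/-- The doubly truncated cone `X(x,G,r,R)`. -/
def coneA (x : R2) (G : Set ℝ) (r R : ℝ) : Set R2 := coneT x G R \ ball x r

/-- Hardy–Littlewood maximal function of a measure on `ℝ`. -/
def maximalFn (ν : Measure ℝ) (t : ℝ) : ℝ≥0∞ :=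
  ⨆ (r : ℝ) (_ : 0 < r), ν (Set.Ioo (t - r) (t + r)) / ENNReal.ofReal (2 * r)

/-- `μ_θ(x) = M(π_θ μ)(π_θ x)`. -/
def projMax (μ : Measure R2) (θ : ℝ) (x : R2) : ℝ≥0∞ :=
  maximalFn (μ.map (proj θ)) (proj θ x)

/-- `μ_θ^⊥(x) = M(π_θ^⊥ μ)(π_θ^⊥ x)`. -/
def projMaxPerp (μ : Measure R2) (θ : ℝ) (x : R2) : ℝ≥0∞ :=
  maximalFn (μ.map (projPerp θ)) (projPerp θ x)

/-- The interval with center `c` and length `ℓ`. -/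
def itv (c ℓ : ℝ) : Set ℝ := Set.Icc (c - ℓ/2) (c + ℓ/2)

/-- The metric `d_I` associated to the interval with center `c` and length `ℓ`. -/
def dmet (c ℓ : ℝ) (x y : R2) : ℝ :=
  Real.sqrt ((ℓ^2)⁻¹ * (projPerp c x - projPerp c y)^2 + (proj c x - proj c y)^2)

/-- The open `d_I`-ball `B_I(x,r)`. -/
def bmet (c ℓ : ℝ) (x : R2) (r : ℝ) : Set R2 := {y | dmet c ℓ x y < r}

/-- Triadic intervals of `[0,1)`. -/
def IsTriadic (I : Set ℝ) : Prop :=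
  ∃ (j k : ℕ), k < 3^j ∧ I = Set.Ico ((k : ℝ)/3^j) ((k+1 : ℝ)/3^j)

/-- 1-dimensional Hausdorff content. -/
def hContent {X : Type*} [EMetricSpace X] (s : Set X) : ℝ≥0∞ :=
  ⨅ (t : ℕ → Set X) (_ : s ⊆ ⋃ n, t n), ∑' n, EMetric.diam (t n)

/-- `E` is a finite union of parallel segments. -/
def FinUnionParallelSegments (E : Set R2) : Prop :=
  ∃ (n : ℕ) (d : R2) (p q : Fin n → R2), d ≠ 0 ∧
    (∀ i, ∃ t : ℝ, q i - p i = t • d) ∧ E = ⋃ i, segment ℝ (p i) (q i)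


theorem projPerp_eq (θ : ℝ) (x : R2) :
    projPerp θ x = x 1 * Real.cos (2 * Real.pi * θ) - x 0 * Real.sin (2 * Real.pi * θ) := by
  have h : 2 * Real.pi * (θ + 1 / 4) = 2 * Real.pi * θ + Real.pi / 2 := by ring
  simp only [projPerp, proj, h, Real.cos_add_pi_div_two, Real.sin_add_pi_div_two]
  ring

theorem measurable_projPerp (θ : ℝ) : Measurable (projPerp θ) := by
  have h : Continuous (projPerp θ) := by
    unfold projPerp proj
    fun_prop
  exact h.measurable

theorem projPerp_add_smul_dir (θ φ t : ℝ) (x : R2) :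
    projPerp θ (x + t • dir φ) =
      projPerp θ x + t * Real.sin (2 * Real.pi * (φ - θ)) := by
  rw [mul_sub, Real.sin_sub, projPerp_eq, projPerp_eq]
  simp [dir]
  ring

theorem projPerp_sub_eq (θ c : ℝ) (x y : R2) :
    projPerp θ x - projPerp θ y =
      Real.cos (2 * Real.pi * (θ - c)) * (projPerp c x - projPerp c y) -
        Real.sin (2 * Real.pi * (θ - c)) * (proj c x - proj c y) := by
  rw [mul_sub (2 * Real.pi), Real.sin_sub, Real.cos_sub]
  simp only [projPerp_eq, proj]
  generalize 2 * Real.pi * θ = b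
  generalize 2 * Real.pi * c = a
  have h := Real.sin_sq_add_cos_sq a
  linear_combination (-(Real.cos b * (x 1 - y 1)) + Real.sin b * (x 0 - y 0)) * h

theorem norm_dir (θ : ℝ) : ‖dir θ‖ = 1 := by
  rw [EuclideanSpace.norm_eq]
  simp [dir]

theorem abs_sin_two_pi_mul_le (s : ℝ) :
    |Real.sin (2 * Real.pi * s)| ≤ 2 * Real.pi * |s| := by
  refine Real.abs_sin_le_abs.trans_eq ?_
  rw [abs_mul, abs_of_pos Real.two_pi_pos]

theorem abs_projPerp_sub_lt_of_mem_bmet {c ℓ r : ℝ} {x y : R2} (hℓ : 0 < ℓ)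
    (h : y ∈ bmet c ℓ x r) : |projPerp c x - projPerp c y| < r * ℓ := by
  have h : dmet c ℓ x y < r := h
  have h1 : |projPerp c x - projPerp c y| / ℓ ≤ dmet c ℓ x y := by
    refine Real.le_sqrt_of_sq_le ?_
    rw [div_pow, sq_abs, div_eq_inv_mul]
    nlinarith [sq_nonneg (proj c x - proj c y)]
  exact (div_lt_iff₀ hℓ).1 (h1.trans_lt h)

theorem abs_proj_sub_lt_of_mem_bmet {c ℓ r : ℝ} {x y : R2}
    (h : y ∈ bmet c ℓ x r) : |proj c x - proj c y| < r := by
  have h : dmet c ℓ x y < r := h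
  refine lt_of_le_of_lt (Real.le_sqrt_of_sq_le ?_) h
  rw [sq_abs]
  have : 0 ≤ (ℓ ^ 2)⁻¹ * (projPerp c x - projPerp c y) ^ 2 := by positivity
  linarith

theorem abs_sub_le_of_mem_itv {c ℓ θ : ℝ} (h : θ ∈ itv c ℓ) : |θ - c| ≤ ℓ / 2 := by
  obtain ⟨h1, h2⟩ := h
  rw [abs_le]
  constructor <;> linarith

theorem measure_preimage_Ioo_le_of_projMaxPerp_le {μ : Measure R2} {θ R : ℝ} {y : R2}
    {m : ℝ≥0∞} (hR : 0 < R) (h : projMaxPerp μ θ y ≤ m) :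
    μ (projPerp θ ⁻¹' Ioo (projPerp θ y - R) (projPerp θ y + R)) ≤
      m * ENNReal.ofReal (2 * R) := by
  have h1 := (le_iSup₂ (f := fun (r : ℝ) (_ : 0 < r) =>
    (μ.map (projPerp θ)) (Ioo (projPerp θ y - r) (projPerp θ y + r)) /
      ENNReal.ofReal (2 * r)) R hR).trans h
  rw [Measure.map_apply (measurable_projPerp θ) measurableSet_Ioo] at h1
  exact (ENNReal.div_le_iff (by simpa using hR) ENNReal.ofReal_ne_top).1 h1

theorem coneT_itv_subset {α c ℓ r θ : ℝ} {x y : R2} (hα : 1 ≤ α) (hr : 0 < r) (hℓ : 0 < ℓ)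
    (hθ : θ ∈ itv c (α * ℓ)) (hy : y ∈ bmet c ℓ x (α * r)) :
    coneT x (itv c ℓ) r ⊆ projPerp θ ⁻¹'
      Ioo (projPerp θ y - 11 * α ^ 2 * ℓ * r) (projPerp θ y + 11 * α ^ 2 * ℓ * r) := by
  rintro z ⟨hz, hzr⟩
  simp only [cone, mem_iUnion, mem_ofPred_eq] at hz
  obtain ⟨φ, hφ, t, rfl⟩ := hz
  have ht : |t| < r := by
    simpa [mem_ball, dist_eq_norm, norm_smul, norm_dir] using hzr
  have hθ' := abs_sub_le_of_mem_itv hθ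
  have hφ' := abs_sub_le_of_mem_itv hφ
  have hφθ : |φ - θ| ≤ α * ℓ := by
    have := abs_sub_le φ c θ
    rw [abs_sub_comm c θ] at this
    nlinarith
  have hpi := Real.pi_pos
  have hpi' := Real.pi_lt_d2
  have hperp := abs_projPerp_sub_lt_of_mem_bmet hℓ hy
  have hpar := abs_proj_sub_lt_of_mem_bmet hy
  have hdir : |t * Real.sin (2 * Real.pi * (φ - θ))| ≤ r * (2 * Real.pi * (α * ℓ)) := by
    rw [abs_mul]
    gcongr
    exact (abs_sin_two_pi_mul_le _).trans (by gcongr)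
  have hcos : |Real.cos (2 * Real.pi * (θ - c)) * (projPerp c x - projPerp c y)| ≤
      1 * (α * r * ℓ) := by
    rw [abs_mul]
    gcongr
    exact Real.abs_cos_le_one _
  have hsin : |Real.sin (2 * Real.pi * (θ - c)) * (proj c x - proj c y)| ≤
      (2 * Real.pi * (α * ℓ / 2)) * (α * r) := by
    rw [abs_mul]
    gcongr
    exact (abs_sin_two_pi_mul_le _).trans (by gcongr)
  have hxy := projPerp_sub_eq θ c x y
  have hα2 : α * (ℓ * r) ≤ α ^ 2 * (ℓ * r) := by
    gcongr
    nlinarith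
  have hpos : 0 < α ^ 2 * (ℓ * r) := by positivity
  have hsum : r * (2 * Real.pi * (α * ℓ)) + 1 * (α * r * ℓ) +
      (2 * Real.pi * (α * ℓ / 2)) * (α * r) < 11 * α ^ 2 * ℓ * r := by
    have h1 : Real.pi * (α * (ℓ * r)) ≤ Real.pi * (α ^ 2 * (ℓ * r)) := by gcongr
    have h2 : Real.pi * (α ^ 2 * (ℓ * r)) < 3.15 * (α ^ 2 * (ℓ * r)) := by gcongr
    linarith
  rw [abs_le] at hdir hcos hsin
  rw [mem_preimage, projPerp_add_smul_dir, mem_Ioo]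
  constructor <;> linarith

theorem measure_coneT_itv_le {α M c ℓ r θ : ℝ} {μ : Measure R2} {x y : R2} (hα : 1 ≤ α)
    (hr : 0 < r) (hℓ : 0 < ℓ) (hθ : θ ∈ itv c (α * ℓ)) (hy : y ∈ bmet c ℓ x (α * r))
    (hM : projMaxPerp μ θ y ≤ ENNReal.ofReal M) :
    μ (coneT x (itv c ℓ) r) ≤ ENNReal.ofReal (22 * α ^ 2 * M * r) * ENNReal.ofReal ℓ := by
  have hR : 0 < 11 * α ^ 2 * ℓ * r := by positivity
  refine (measure_mono (coneT_itv_subset hα hr hℓ hθ hy)).trans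
    ((measure_preimage_Ioo_le_of_projMaxPerp_le hR hM).trans_eq ?_)
  rw [← ENNReal.ofReal_mul' (by positivity), ← ENNReal.ofReal_mul' hℓ.le]
  congr 1
  ring

theorem coneT_iUnion {ι : Type*} (x : R2) (s : ι → Set ℝ) (r : ℝ) :
    coneT x (⋃ i, s i) r = ⋃ i, coneT x (s i) r := by
  simp only [coneT, cone, biUnion_iUnion, iUnion_inter]

theorem countable_of_pairwise_disjoint_itv {ι : Type*} {c ℓ : ι → ℝ} (hℓ : ∀ i, 0 < ℓ i)
    (hd : Pairwise fun i j => Disjoint (itv (c i) (ℓ i)) (itv (c j) (ℓ j))) :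
    Countable ι := by
  have h := Set.PairwiseDisjoint.countable_of_nonempty_interior
    (s := fun i => itv (c i) (ℓ i)) (a := Set.univ) (fun i _ j _ hij => hd hij) (fun i _ => by
      simp only [itv, interior_Icc, nonempty_Ioo]
      linarith [hℓ i])
  exact countable_univ_iff.1 h

theorem hausdorffMeasure_one_iUnion_itv {ι : Type*} [Countable ι] {c ℓ : ι → ℝ}
    (hd : Pairwise fun i j => Disjoint (itv (c i) (ℓ i)) (itv (c j) (ℓ j))) :
    μH[1] (⋃ i, itv (c i) (ℓ i)) = ∑' i, ENNReal.ofReal (ℓ i) := by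
  rw [hausdorffMeasure_real, measure_iUnion hd fun i => measurableSet_Icc]
  refine tsum_congr fun i => ?_
  rw [itv, Real.volume_Icc]
  congr 1
  ring

/-- cone measure bounds from maximal function bounds on a disjoint family. -/
theorem statement11 :
    ∃ C : ℝ, 0 < C ∧
      ∀ (α M : ℝ) (μ : Measure R2), IsLocallyFiniteMeasure μ →
        ∀ (ι : Type) (c ℓ : ι → ℝ) (x : R2) (r : ℝ),
          1 ≤ α → 0 < r →
          (∀ i, 0 < ℓ i) →
          (∀ i, itv (c i) (ℓ i) ⊆ Set.Ico (0:ℝ) 1) →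
          (Pairwise fun i j => Disjoint (itv (c i) (ℓ i)) (itv (c j) (ℓ j))) →
          (∀ i, ∃ θ ∈ itv (c i) (α * ℓ i), ∃ y ∈ bmet (c i) (ℓ i) x (α * r),
            projMaxPerp μ θ y ≤ ENNReal.ofReal M) →
          μ (coneT x (⋃ i, itv (c i) (ℓ i)) r) ≤
            ENNReal.ofReal (C * α^2 * M * r) * μH[1] (⋃ i, itv (c i) (ℓ i)) := by
  refine ⟨22, by norm_num, fun α M μ _ ι c ℓ x r hα hr hℓ _ hd h => ?_⟩
  have := countable_of_pairwise_disjoint_itv hℓ hd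
  rw [coneT_iUnion, hausdorffMeasure_one_iUnion_itv hd, ← ENNReal.tsum_mul_left]
  refine (measure_iUnion_le _).trans (ENNReal.tsum_le_tsum fun i => ?_)
  obtain ⟨θ, hθ, y, hy, hM⟩ := h i
  exact measure_coneT_itv_le hα hr (hℓ i) hθ hy hM

end
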